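/- arXiv:2102.00401 — 2 statements merged into one kernel-verified Lean document; each statement's English description precedes it below -/
import Mathlib

section
/- Let n be a positive integer and let X be a regular curve of almost ≤ n order. Then no nilpotent group admits a sensitive action on X by homeomorphisms; that is, if a group G acts sensitively on X by homeomorphisms, then G is not nilpotent. -/
open scoped Pointwise Topology commutatorElement

/-- A continuum with a basis of open sets with finite boundary is locally connected. -/
theorem locallyConnectedSpace_of_finite_frontier
    {X : Type*} [TopologicalSpace X] [T2Space X] [CompactSpace X] [ConnectedSpace X]
    (hreg : ∀ (x : X) (U : Set X), IsOpen U → x ∈ U →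
      ∃ V : Set X, IsOpen V ∧ x ∈ V ∧ V ⊆ U ∧ (frontier V).Finite) :
    LocallyConnectedSpace X := by
  rw [locallyConnectedSpace_iff_connected_subsets]
  intro x U hU
  obtain ⟨T, hTx, hTc, hTU⟩ := exists_mem_nhds_isClosed_subset hU
  obtain ⟨V, hVo, hxV, hVT, hF⟩ := hreg x (interior T) isOpen_interior
    (mem_interior_iff_mem_nhds.2 hTx)
  have hVU : closure V ⊆ U :=
    (closure_minimal (hVT.trans interior_subset) hTc).trans hTU
  have : CompactSpace (closure V) := isCompact_iff_compactSpace.1 isClosed_closure.isCompact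
  let z : closure V := ⟨x, subset_closure hxV⟩
  -- a clopen subset of `closure V` missing the frontier is clopen in `X`
  have key : ∀ E : Set (closure V), IsClopen E → (∀ e ∈ E, (e : X) ∉ frontier V) →
      z ∉ E → E = ∅ := by
    intro E hE hEF hzE
    have hEV : Subtype.val '' E ⊆ V := by
      rintro _ ⟨e, he, rfl⟩
      by_contra h
      exact hEF e he ⟨e.2, by rwa [hVo.interior_eq]⟩
    have hcl : IsClosed (Subtype.val '' E : Set X) :=
      isClosed_closure.isClosedEmbedding_subtypeVal.isClosedMap _ hE.1
    have hop : IsOpen (Subtype.val '' E : Set X) := by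
      obtain ⟨O, hO, rfl⟩ := isOpen_induced_iff.1 hE.2
      have : (Subtype.val '' (Subtype.val ⁻¹' O : Set (closure V)) : Set X) = O ∩ V := by
        apply Set.Subset.antisymm
        · intro y hy
          exact ⟨by obtain ⟨e, he, rfl⟩ := hy; exact he, hEV hy⟩
        · rintro y ⟨hyO, hyV⟩
          exact ⟨⟨y, subset_closure hyV⟩, hyO, rfl⟩
      rw [this]
      exact hO.inter hVo
    rcases isClopen_iff.1 (⟨hcl, hop⟩ : IsClopen (Subtype.val '' E : Set X)) with h | h
    · exact Set.image_eq_empty.1 h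
    · obtain ⟨e, he, hex⟩ : x ∈ (Subtype.val '' E : Set X) := h ▸ Set.mem_univ x
      exact absurd (by rwa [show z = e from Subtype.ext hex.symm]) hzE
  have hsep : ∀ f : closure V, f ∉ connectedComponent z →
      ∃ C : Set (closure V), IsClopen C ∧ z ∈ C ∧ f ∉ C := by
    intro f hf
    rw [connectedComponent_eq_iInter_isClopen] at hf
    simp only [Set.mem_iInter, not_forall] at hf
    obtain ⟨⟨C, hC, hzC⟩, hfC⟩ := hf
    exact ⟨C, hC, hzC, hfC⟩
  choose! C hC hzC hfC using hsep
  let B : Set (closure V) := {f | (f : X) ∈ frontier V ∧ f ∉ connectedComponent z}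
  have hB : B.Finite :=
    (hF.preimage Subtype.val_injective.injOn).subset fun f hf => hf.1
  let K : Set (closure V) := ⋂ f ∈ B, C f
  have hK : IsClopen K := hB.isClopen_biInter fun f hf => hC f hf.2
  have hzK : z ∈ K := Set.mem_iInter₂.2 fun f hf => hzC f hf.2
  have hKcomp : K ⊆ connectedComponent z := by
    rw [connectedComponent_eq_iInter_isClopen]
    refine Set.subset_iInter ?_
    rintro ⟨D, hD, hzD⟩
    rw [← Set.sdiff_eq_empty]
    refine key _ (hK.diff hD) ?_ fun h => h.2 hzD
    rintro e ⟨heK, heD⟩ heF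
    have : e ∉ connectedComponent z := fun h => heD (hD.connectedComponent_subset hzD h)
    exact hfC e this (Set.mem_iInter₂.1 heK e ⟨heF, this⟩)
  refine ⟨Subtype.val '' connectedComponent z, ?_,
    isPreconnected_connectedComponent.image _ continuous_subtype_val.continuousOn, ?_⟩
  · have hn : connectedComponent z ∈ 𝓝 z := Filter.mem_of_superset (hK.2.mem_nhds hzK) hKcomp
    have hc : closure V ∈ 𝓝 x := Filter.mem_of_superset (hVo.mem_nhds hxV) subset_closure
    have := Filter.image_mem_map (m := (Subtype.val : closure V → X)) hn
    rwa [map_nhds_subtype_coe_eq_nhds (subset_closure hxV) hc] at this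
  · rintro _ ⟨e, -, rfl⟩
    exact hVU e.2

/-- In a locally connected space, every nonempty open set of finite boundary contains a nonempty
connected open set whose boundary is contained in that of the given set. -/
theorem IsOpen.exists_isConnected_frontier_subset
    {X : Type*} [TopologicalSpace X] [LocallyConnectedSpace X]
    {V : Set X} (hV : IsOpen V) (hne : V.Nonempty) :
    ∃ W ⊆ V, IsOpen W ∧ IsConnected W ∧ frontier W ⊆ frontier V := by
  obtain ⟨x, hx⟩ := hne
  refine ⟨connectedComponentIn V x, connectedComponentIn_subset V x,
    hV.connectedComponentIn, isConnected_connectedComponentIn_iff.2 hx, ?_⟩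
  intro y hy
  refine ⟨closure_mono (connectedComponentIn_subset V x) hy.1, fun hyV => ?_⟩
  rw [hV.interior_eq] at hyV
  have hW : IsOpen (connectedComponentIn V x) := hV.connectedComponentIn
  obtain ⟨w, hwy, hwx⟩ := mem_closure_iff.1 hy.1 _ hV.connectedComponentIn
    (mem_connectedComponentIn hyV)
  apply hy.2
  rw [hW.interior_eq, connectedComponentIn_eq hwx, ← connectedComponentIn_eq hwy]
  exact mem_connectedComponentIn hyV

/-- A connected set meeting an open set `W` and missing its frontier lies in `W`. -/
theorem IsPreconnected.subset_of_disjoint_frontier {X : Type*} [TopologicalSpace X]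
    {N W : Set X} (hN : IsPreconnected N) (hW : IsOpen W) (hne : (N ∩ W).Nonempty)
    (hd : Disjoint N (frontier W)) : N ⊆ W := by
  refine hN.subset_left_of_subset_union hW isClosed_closure.isOpen_compl
    (disjoint_compl_right.mono_left subset_closure) ?_ hne
  intro y hy
  by_cases h : y ∈ W
  · exact Or.inl h
  · refine Or.inr fun hc => Set.disjoint_left.1 hd hy ⟨hc, by rwa [hW.interior_eq]⟩

/-- Connected open sets of large diameter and small boundary in a compact locally connected
metric space each contain a member of a fixed finite family of nonempty open sets. -/
theorem exists_finite_family_subset_of_lt_diam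
    {X : Type*} [MetricSpace X] [CompactSpace X] [LocallyConnectedSpace X]
    (n : ℕ) {c : ℝ} (hc : 0 < c) :
    ∃ t : Finset X, ∃ N : X → Set X, (∀ x, IsOpen (N x) ∧ (N x).Nonempty) ∧
      ∀ W : Set X, IsOpen W → IsConnected W → c < Metric.diam W → (frontier W).Finite →
        (frontier W).ncard ≤ n → ∃ x ∈ t, N x ⊆ W := by
  set δ : ℝ := c / (n + 1) with hδ
  have hδ0 : 0 < δ := by positivity
  let N : X → Set X := fun x => connectedComponentIn (Metric.ball x (δ / 4)) x
  have hxb : ∀ x : X, x ∈ Metric.ball x (δ / 4) := fun x =>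
    Metric.mem_ball_self (by positivity)
  have hNo : ∀ x, IsOpen (N x) := fun x => Metric.isOpen_ball.connectedComponentIn
  have hxN : ∀ x, x ∈ N x := fun x => mem_connectedComponentIn (hxb x)
  obtain ⟨t, ht⟩ := CompactSpace.elim_nhds_subcover N fun x => (hNo x).mem_nhds (hxN x)
  refine ⟨t, N, fun x => ⟨hNo x, x, hxN x⟩, fun W hW hWc hdiam hfin hcard => ?_⟩
  obtain ⟨a, ha, b, hb, hab⟩ : ∃ a ∈ W, ∃ b ∈ W, c < dist a b := by
    by_contra! h
    exact absurd (Metric.diam_le_of_forall_dist_le hc.le h) (not_le.2 hdiam)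
  have hiv : Set.Icc (dist a a) (dist a b) ⊆ (dist a) '' W :=
    hWc.isPreconnected.intermediate_value ha hb (continuous_const.dist continuous_id).continuousOn
  have hpts : ∀ i : Fin (n + 1), ∃ x ∈ W, dist a x = i * δ := by
    intro i
    refine hiv ⟨by rw [dist_self]; positivity, ?_⟩
    have h1 : ((i : ℕ) : ℝ) ≤ n + 1 := by exact_mod_cast i.2.le
    have h2 : ((i : ℕ) : ℝ) * δ ≤ (n + 1) * δ := by gcongr
    have h3 : ((n : ℝ) + 1) * δ = c := by rw [hδ]; field_simp
    linarith
  choose x hxW hax using hpts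
  by_contra! hcon
  have hp : ∀ i, ∃ p ∈ frontier W, dist (x i) p < δ / 2 := by
    intro i
    obtain ⟨q, hq, hxq⟩ : ∃ q ∈ t, x i ∈ N q := by
      have : x i ∈ ⋃ q ∈ t, N q := ht ▸ Set.mem_univ _
      simpa using this
    have hnd : ¬ Disjoint (N q) (frontier W) := fun hd =>
      hcon q hq (isPreconnected_connectedComponentIn.subset_of_disjoint_frontier hW
        ⟨x i, hxq, hxW i⟩ hd)
    obtain ⟨p, hpN, hpW⟩ := Set.not_disjoint_iff.1 hnd
    have h1 := Metric.mem_ball.1 (connectedComponentIn_subset _ _ hxq)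
    have h2 := Metric.mem_ball.1 (connectedComponentIn_subset _ _ hpN)
    exact ⟨p, hpW, by linarith [dist_triangle_right (x i) p q]⟩
  choose p hpW hpx using hp
  have hinj : Function.Injective p := by
    intro i j hij
    by_contra hne
    have hij' : (1 : ℝ) ≤ |((i : ℕ) : ℝ) - ((j : ℕ) : ℝ)| := by
      have h : (1 : ℤ) ≤ |((i : ℕ) : ℤ) - ((j : ℕ) : ℤ)| :=
        Int.one_le_abs (sub_ne_zero.2 fun h => hne (Fin.ext (by exact_mod_cast h)))
      exact_mod_cast h
    have h1 : |dist a (x i) - dist a (x j)| ≤ dist (x i) (x j) := by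
      rw [dist_comm a, dist_comm a]
      exact abs_dist_sub_le _ _ _
    rw [hax, hax, ← sub_mul, abs_mul, abs_of_pos hδ0] at h1
    have h2 := hpx i
    have h3 := hpx j
    rw [← hij] at h3
    have h4 := dist_triangle_right (x i) (x j) (p i)
    nlinarith
  have := Set.ncard_le_ncard (Set.range_subset_iff.2 hpW) hfin
  rw [Set.ncard_range_of_injective hinj, Nat.card_eq_fintype_card, Fintype.card_fin] at this
  omega

/-- If translates of finitely many nonempty open sets can be found inside every nonempty open set
of a Hausdorff space without isolated points, then two translates of one of these sets are
disjoint and contained in it. -/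
theorem exists_disjoint_smul_subset
    {X G ι : Type*} [TopologicalSpace X] [T2Space X] [Group G] [MulAction G X]
    [Finite ι] [Nonempty ι] (hX : ∀ x : X, (𝓝[≠] x).NeBot)
    (O : ι → Set X) (hO : ∀ i, IsOpen (O i)) (hne : ∀ i, (O i).Nonempty)
    (h : ∀ U : Set X, IsOpen U → U.Nonempty → ∃ i, ∃ g : G, g • O i ⊆ U) :
    ∃ i, ∃ g k : G, g • O i ⊆ O i ∧ k • O i ⊆ O i ∧ Disjoint (g • O i) (k • O i) := by
  let _ : Preorder ι :=
    { le := fun i j => ∃ g : G, g • O i ⊆ O j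
      le_refl := fun i => ⟨1, by rw [one_smul]⟩
      le_trans := by
        rintro i j k ⟨g, hg⟩ ⟨l, hl⟩
        exact ⟨l * g, by rw [mul_smul]; exact (Set.smul_set_mono hg).trans hl⟩ }
  obtain ⟨i, -, hi⟩ := Set.finite_univ.exists_minimal (Set.univ_nonempty (α := ι))
  have hself : ∀ U ⊆ O i, IsOpen U → U.Nonempty → ∃ g : G, g • O i ⊆ U := by
    intro U hUO hU hUne
    obtain ⟨j, g, hg⟩ := h U hU hUne
    obtain ⟨l, hl⟩ : i ≤ j := hi (Set.mem_univ j) ⟨g, hg.trans hUO⟩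
    exact ⟨g * l, by rw [mul_smul]; exact (Set.smul_set_mono hl).trans hg⟩
  obtain ⟨x, hx⟩ := hne i
  have := hX x
  obtain ⟨y, hy, hyx⟩ : ∃ y ∈ O i, y ≠ x :=
    (Filter.inter_mem (mem_nhdsWithin_of_mem_nhds ((hO i).mem_nhds hx))
      (self_mem_nhdsWithin (s := {x}ᶜ)) |> (𝓝[≠] x).nonempty_of_mem)
  obtain ⟨A, B, hA, hB, hyA, hxB, hAB⟩ := t2_separation hyx
  obtain ⟨g, hg⟩ := hself (A ∩ O i) Set.inter_subset_right (hA.inter (hO i)) ⟨y, hyA, hy⟩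
  obtain ⟨k, hk⟩ := hself (B ∩ O i) Set.inter_subset_right (hB.inter (hO i)) ⟨x, hxB, hx⟩
  exact ⟨i, g, k, hg.trans Set.inter_subset_right, hk.trans Set.inter_subset_right,
    hAB.mono (hg.trans Set.inter_subset_left) (hk.trans Set.inter_subset_left)⟩

/-- A group acting on a set with a ping-pong pair is not nilpotent. -/
theorem not_isNilpotent_of_disjoint_smul_subset
    {X G : Type*} [Group G] [MulAction G X] {O : Set X} (hne : O.Nonempty) {x y : G}
    (hx : x • O ⊆ O) (hy : y • O ⊆ O) (hd : Disjoint (x • O) (y • O)) :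
    ¬ Group.IsNilpotent G := by
  intro hG
  have key : ∀ i : ℕ, ∃ a b : G, a * b⁻¹ ∈ Subgroup.lowerCentralSeries (⊤ : Subgroup G) i ∧
      a • O ⊆ x • O ∧ b • O ⊆ y • O := by
    intro i
    induction i with
    | zero => exact ⟨x, y, by simp, subset_rfl, subset_rfl⟩
    | succ i ih =>
      obtain ⟨a, b, hab, ha, hb⟩ := ih
      refine ⟨a * b, b * a, ?_, ?_, ?_⟩
      · have : a * b * (b * a)⁻¹ = ⁅a * b⁻¹, b⁆ := by
          rw [commutatorElement_def]; group
        rw [this]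
        exact Subgroup.commutator_mem_commutator hab (Subgroup.mem_top b)
      · rw [mul_smul]
        exact (Set.smul_set_mono (hb.trans hy)).trans ha
      · rw [mul_smul]
        exact (Set.smul_set_mono (ha.trans hx)).trans hb
  obtain ⟨m, hm⟩ := Subgroup.nilpotent_iff_lowerCentralSeries.1 hG
  obtain ⟨a, b, hab, ha, hb⟩ := key m
  rw [hm, Subgroup.mem_bot, mul_inv_eq_one] at hab
  subst hab
  obtain ⟨p, hp⟩ := hne.smul_set (a := a)
  exact Set.disjoint_left.1 hd (ha hp) (hb hp)

/-- No nilpotent group admits a sensitive action by homeomorphisms on a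
regular curve of almost `≤ n` order. -/
theorem no_sensitive_nilpotent_action_on_regular_curve
    {X : Type*} [MetricSpace X] [CompactSpace X] [ConnectedSpace X]
    (hreg : ∀ (x : X) (U : Set X), IsOpen U → x ∈ U →
      ∃ V : Set X, IsOpen V ∧ x ∈ V ∧ V ⊆ U ∧ (frontier V).Finite)
    (n : ℕ) (hn : 0 < n)
    (horder : ∀ U : Set X, IsOpen U → U.Nonempty →
      ∃ V : Set X, IsOpen V ∧ V.Nonempty ∧ V ⊆ U ∧
        (frontier V).Finite ∧ (frontier V).ncard ≤ n)
    {G : Type*} [Group G] [MulAction G X]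
    (hcont : ∀ g : G, Continuous fun x : X => g • x)
    (hsens : ∃ c > (0 : ℝ), ∀ U : Set X, IsOpen U → U.Nonempty →
      ∃ g : G, c < Metric.diam ((fun x => g • x) '' U)) :
    ¬ Group.IsNilpotent G := by
  have := locallyConnectedSpace_of_finite_frontier hreg
  have : ContinuousConstSMul G X := ⟨hcont⟩
  obtain ⟨c, hc, hsens⟩ := hsens
  obtain ⟨t, N, hN, hbig⟩ := exists_finite_family_subset_of_lt_diam (X := X) n hc
  have hshrink : ∀ U : Set X, IsOpen U → U.Nonempty → ∃ i : t, ∃ g : G, g • N i ⊆ U := by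
    intro U hU hUne
    obtain ⟨V, hV, hVne, hVU, hVfin, hVcard⟩ := horder U hU hUne
    obtain ⟨W, hWV, hW, hWc, hWf⟩ := hV.exists_isConnected_frontier_subset hVne
    obtain ⟨g, hg⟩ := hsens W hW hWc.nonempty
    have hfr : frontier (g • W) = g • frontier W :=
      ((Homeomorph.smul g).image_frontier W).symm
    obtain ⟨q, hq, hqW⟩ := hbig (g • W) (hW.smul g)
      (hWc.image _ (hcont g).continuousOn) hg
      (by rw [hfr]; exact (hVfin.subset hWf).image _)
      (by
        rw [hfr]
        exact (Set.ncard_image_le (hVfin.subset hWf)).trans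
          ((Set.ncard_le_ncard hWf hVfin).trans hVcard))
    exact ⟨⟨q, hq⟩, g⁻¹, (Set.smul_set_subset_iff_subset_inv_smul_set.2
      (by rwa [inv_inv])).trans (hWV.trans hVU)⟩
  have : Nontrivial X := by
    by_contra h
    have := not_nontrivial_iff_subsingleton.1 h
    obtain ⟨g, hg⟩ := hsens Set.univ isOpen_univ Set.univ_nonempty
    rw [Metric.diam_subsingleton (Set.subsingleton_of_subsingleton)] at hg
    exact hc.not_gt hg
  obtain ⟨i₀, -⟩ := hshrink Set.univ isOpen_univ Set.univ_nonempty
  have : Nonempty t := ⟨i₀⟩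
  obtain ⟨i, x, y, hx, hy, hd⟩ := exists_disjoint_smul_subset (G := G)
    (fun x : X => inferInstance) (fun i : t => N i) (fun i => (hN i).1) (fun i => (hN i).2) hshrink
  exact not_isNilpotent_of_disjoint_smul_subset (hN i).2 hx hy hd
end

section
/- Let n be a positive integer, let X be a regular curve of almost ≤ n order, and let G be a group acting on X by homeomorphisms such that the action is sensitive. Then there exist a nonempty open set D ⊆ X, nonempty open sets B1, B2 ⊆ D with B1 ∩ B2 = ∅, and elements h1, h2 ∈ G such that h1(D) ⊆ B1 and h2(D) ⊆ B2 (i.e., (D, B1, B2, h1, h2) is a semi ping pong). -/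
/-- In a preconnected regular space with a basis of open sets with finite boundary, connected
open sets form a basis. -/
theorem locallyConnectedSpace_of_finite_frontier_basis {X : Type*} [TopologicalSpace X]
    [RegularSpace X] [PreconnectedSpace X]
    (hreg : ∀ (x : X) (U : Set X), IsOpen U → x ∈ U →
      ∃ V : Set X, IsOpen V ∧ x ∈ V ∧ V ⊆ U ∧ (frontier V).Finite) :
    LocallyConnectedSpace X := by
  rw [locallyConnectedSpace_iff_connected_subsets]
  intro x U hU
  obtain ⟨C, hC, hCc, hCU⟩ := exists_mem_nhds_isClosed_subset hU
  obtain ⟨V, hVo, hxV, hVC, hVf⟩ :=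
    hreg x (interior C) isOpen_interior (mem_interior_iff_mem_nhds.2 hC)
  have hclV : closure V ⊆ U :=
    (closure_minimal (hVC.trans interior_subset) hCc).trans hCU
  let P : Set (Set X) :=
    {K | IsClosed K ∧ x ∈ K ∧ K ⊆ closure V ∧ IsClosed (closure V \ K)}
  have hP : closure V ∈ P := ⟨isClosed_closure, subset_closure hxV, subset_rfl, by simp⟩
  obtain ⟨K, ⟨hKc, hxK, hKV, hVK⟩, hmin⟩ :=
    (measure fun K : Set X => (K ∩ frontier V).ncard).wf.has_min P ⟨_, hP⟩
  have hsplit : ∀ t t' : Set X, IsClosed t → IsClosed t' → K ⊆ t ∪ t' → x ∈ t →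
      (K ∩ t').Nonempty → (K ∩ (t ∩ t')).Nonempty := by
    intro t t' ht ht' hKt hxt hne
    by_contra hemp
    rw [Set.not_nonempty_iff_eq_empty] at hemp
    have hdisj : ∀ y ∈ K, y ∈ t → y ∉ t' := fun y hy h1 h2 =>
      (hemp ▸ ⟨hy, h1, h2⟩ : y ∈ (∅ : Set X))
    have hA : K ∩ t ∈ P := by
      refine ⟨hKc.inter ht, ⟨hxK, hxt⟩, Set.inter_subset_left.trans hKV, ?_⟩
      have : closure V \ (K ∩ t) = (closure V \ K) ∪ (K ∩ t') := by
        ext y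
        have h1 := @hKV y
        have h2 := @hKt y
        have h3 := hdisj y
        simp only [Set.mem_sdiff, Set.mem_inter_iff, Set.mem_union] at *
        tauto
      rw [this]
      exact hVK.union (hKc.inter ht')
    obtain ⟨b, ⟨hbK, hbt'⟩, hbf⟩ : ((K ∩ t') ∩ frontier V).Nonempty := by
      by_contra hno
      rw [Set.not_nonempty_iff_eq_empty] at hno
      have hBV : ∀ y ∈ K, y ∈ t' → y ∈ V := by
        intro y hy hyt
        by_contra hyV
        have : y ∈ K ∩ t' ∩ frontier V := ⟨⟨hy, hyt⟩, by
          rw [hVo.frontier_eq]; exact ⟨hKV hy, hyV⟩⟩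
        simp [hno] at this
      have hBeq : K ∩ t' = V \ ((closure V \ K) ∪ (K ∩ t)) := by
        ext y
        have h1 := hBV y
        have h2 := @hKt y
        have h3 := hdisj y
        have h4 := @subset_closure _ _ V y
        simp only [Set.mem_sdiff, Set.mem_inter_iff, Set.mem_union] at *
        tauto
      have hB : IsClopen (K ∩ t') :=
        ⟨hKc.inter ht', hBeq ▸ hVo.sdiff (hVK.union (hKc.inter ht))⟩
      rcases isClopen_iff.1 hB with h | h
      · exact hne.ne_empty h
      · exact hdisj x hxK hxt (h ▸ Set.mem_univ x : x ∈ K ∩ t').2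
    refine hmin _ hA (Set.ncard_lt_ncard ?_ (hVf.subset Set.inter_subset_right))
    refine ⟨Set.inter_subset_inter_left _ Set.inter_subset_left, fun h => ?_⟩
    exact hdisj b hbK (h ⟨hbK, hbf⟩).1.2 hbt'
  refine ⟨K, ?_, ?_, hKV.trans hclV⟩
  · refine Filter.mem_of_superset ((hVo.sdiff hVK).mem_nhds ⟨hxV, fun h => h.2 hxK⟩) ?_
    intro y hy
    by_contra hyK
    exact hy.2 ⟨subset_closure hy.1, hyK⟩
  · rw [isPreconnected_closed_iff]
    intro t t' ht ht' hKt hne hne'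
    rcases hKt hxK with hx | hx
    · exact hsplit t t' ht ht' hKt hx hne'
    · rw [Set.inter_comm t t']
      exact hsplit t' t ht' ht (Set.union_comm t t' ▸ hKt) hx hne

theorem IsPreconnected.inter_frontier_nonempty_of_not_subset {X : Type*} [TopologicalSpace X]
    {s U : Set X} (hs : IsPreconnected s) (hU : IsOpen U) (hne : (s ∩ U).Nonempty)
    (hsU : ¬ s ⊆ U) : (s ∩ frontier U).Nonempty := by
  by_contra hno
  rw [Set.not_nonempty_iff_eq_empty] at hno
  refine hsU (hs.subset_left_of_subset_union hU isClosed_closure.isOpen_compl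
    (Set.disjoint_compl_right_iff_subset.2 subset_closure) (fun y hy => ?_) hne)
  by_contra hyU
  simp only [Set.mem_union, Set.mem_compl_iff, not_or, not_not] at hyU
  have : y ∈ s ∩ frontier U := ⟨hy, by rw [hU.frontier_eq]; exact ⟨hyU.2, hyU.1⟩⟩
  simp [hno] at this

theorem frontier_connectedComponentIn_subset {X : Type*} [TopologicalSpace X]
    [LocallyConnectedSpace X] {V : Set X} (hV : IsOpen V) (x : X) :
    frontier (connectedComponentIn V x) ⊆ frontier V := by
  intro y hy
  have hCo : IsOpen (connectedComponentIn V x) := hV.connectedComponentIn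
  rw [hCo.frontier_eq] at hy
  rw [hV.frontier_eq]
  refine ⟨closure_mono (connectedComponentIn_subset V x) hy.1, fun hyV => hy.2 ?_⟩
  obtain ⟨z, hzy, hzx⟩ := mem_closure_iff.1 hy.1 _ hV.connectedComponentIn
    (mem_connectedComponentIn hyV)
  rw [connectedComponentIn_eq hzx, ← connectedComponentIn_eq hzy]
  exact mem_connectedComponentIn hyV

/-- Among a finite cover by small connected sets, every connected open set of large diameter with
at most `n` boundary points contains a member of the cover. -/
theorem exists_finite_family_subset_of_ncard_frontier_le {X : Type*} [MetricSpace X]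
    [CompactSpace X] [LocallyConnectedSpace X] (n : ℕ) {c : ℝ} (hc : 0 < c) :
    ∃ S : Set (Set X), S.Finite ∧ (∀ W ∈ S, IsOpen W ∧ W.Nonempty) ∧
      ∀ U : Set X, IsOpen U → IsPreconnected U → (frontier U).Finite →
        (frontier U).ncard ≤ n → c < Metric.diam U → ∃ W ∈ S, W ⊆ U := by
  set δ : ℝ := c / (n + 1) with hδ
  have hδ0 : 0 < δ := by positivity
  have hnb : ∀ x : X, ∃ W : Set X, IsOpen W ∧ x ∈ W ∧ IsPreconnected W ∧
      W ⊆ Metric.ball x (δ / 4) := by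
    intro x
    refine ⟨connectedComponentIn (Metric.ball x (δ / 4)) x, Metric.isOpen_ball.connectedComponentIn,
      mem_connectedComponentIn (Metric.mem_ball_self (by positivity)),
      isPreconnected_connectedComponentIn, connectedComponentIn_subset _ _⟩
  choose W hWo hxW hWc hWb using hnb
  obtain ⟨T, hT⟩ := isCompact_univ.elim_finite_subcover W hWo
    fun x _ => Set.mem_iUnion.2 ⟨x, hxW x⟩
  refine ⟨W '' T, T.finite_toSet.image _, ?_, ?_⟩
  · rintro _ ⟨x, -, rfl⟩
    exact ⟨hWo x, x, hxW x⟩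
  intro U hU hUc hUf hUn hUd
  by_contra hno
  obtain ⟨p, hp, q, hq, hpq⟩ : ∃ p ∈ U, ∃ q ∈ U, c < dist p q := by
    by_contra! h
    exact hUd.not_ge (Metric.diam_le_of_forall_dist_le hc.le h)
  have himg : IsPreconnected ((fun y => dist p y) '' U) :=
    hUc.image _ (by fun_prop)
  have hval : ∀ k : Fin (n + 1), ∃ y ∈ U, dist p y = δ * k := by
    intro k
    have hk : ((k : ℕ) : ℝ) ≤ n + 1 := by exact_mod_cast k.2.le
    have : δ * k ∈ (fun y => dist p y) '' U := by
      refine himg.Icc_subset ⟨p, hp, rfl⟩ ⟨q, hq, rfl⟩ ⟨by simp; positivity, ?_⟩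
      refine le_trans ?_ hpq.le
      calc δ * k ≤ δ * (n + 1) := by gcongr
        _ = c := by rw [hδ]; field_simp
    exact this
  choose u huU hu using hval
  have hbd : ∀ k, ∃ b ∈ frontier U, dist b (u k) < δ / 2 := by
    intro k
    obtain ⟨x, hxT, hx⟩ : ∃ x ∈ T, u k ∈ W x := by simpa using hT (Set.mem_univ (u k))
    obtain ⟨b, hbW, hb⟩ := (hWc x).inter_frontier_nonempty_of_not_subset hU ⟨u k, hx, huU k⟩
      fun h => hno ⟨W x, ⟨x, hxT, rfl⟩, h⟩
    refine ⟨b, hb, ?_⟩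
    have h1 := Metric.mem_ball.1 (hWb x hbW)
    have h2 := Metric.mem_ball.1 (hWb x hx)
    linarith [dist_triangle_right b (u k) x]
  choose b hbf hbu using hbd
  have hinj : Function.Injective b := by
    intro j k hjk
    by_contra hne
    have h1 := hbu j
    have h2 := hbu k
    rw [← hjk] at h2
    have h3 : |dist p (u j) - dist p (u k)| < δ := by
      have := abs_dist_sub_le (u j) (u k) p
      rw [dist_comm p, dist_comm p]
      linarith [dist_triangle_left (u j) (u k) (b j)]
    rw [hu, hu, ← mul_sub, abs_mul, abs_of_pos hδ0] at h3
    have h4 : (1 : ℝ) ≤ |((j : ℕ) : ℝ) - (k : ℕ)| := by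
      have : (1 : ℤ) ≤ |((j : ℕ) : ℤ) - (k : ℕ)| :=
        Int.one_le_abs (by have := Fin.val_ne_of_ne hne; lia)
      exact_mod_cast this
    nlinarith
  have hcard : n + 1 ≤ (frontier U).ncard := by
    have := Set.ncard_le_ncard (Set.range_subset_iff.2 hbf) hUf
    rwa [Set.ncard_range_of_injective hinj, Nat.card_fin] at this
  lia

open scoped Pointwise in
/-- If finitely many sets are such that each nonempty open set contains a translate of one
of them, then some member `W` has translates in every nonempty open subset of itself. -/
theorem exists_mem_forall_isOpen_exists_smul_subset {X G : Type*} [TopologicalSpace X] [Group G]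
    [MulAction G X] [Nonempty X] {S : Set (Set X)} (hS : S.Finite)
    (h : ∀ O : Set X, IsOpen O → O.Nonempty → ∃ W ∈ S, ∃ g : G, g • W ⊆ O) :
    ∃ W ∈ S, ∀ O ⊆ W, IsOpen O → O.Nonempty → ∃ g : G, g • W ⊆ O := by
  let L : Set X → Set (Set X) := fun W => {W' ∈ S | ∃ g : G, g • W' ⊆ W}
  obtain ⟨W₀, hW₀, -⟩ := h Set.univ isOpen_univ Set.univ_nonempty
  obtain ⟨W, hW, hmin⟩ := Set.exists_min_image S (fun W => (L W).ncard) hS ⟨W₀, hW₀⟩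
  refine ⟨W, hW, fun O hOW hO hOne => ?_⟩
  obtain ⟨W', hW', g, hg⟩ := h O hO hOne
  have hL : L W' ⊆ L W := by
    rintro A ⟨hA, k, hk⟩
    refine ⟨hA, g * k, ?_⟩
    rw [mul_smul]
    exact ((Set.smul_set_mono hk).trans hg).trans hOW
  have heq : L W' = L W :=
    Set.eq_of_subset_of_ncard_le hL (hmin W' hW') (hS.subset (Set.sep_subset _ _))
  have hWL : W ∈ L W' := heq ▸ ⟨hW, 1, by rw [one_smul]⟩
  obtain ⟨-, k, hk⟩ := hWL
  refine ⟨g * k, ?_⟩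
  rw [mul_smul]
  exact (Set.smul_set_mono hk).trans hg


/-- A sensitive action of a group `G` by homeomorphisms on a regular curve of
almost `≤ n` order admits a semi ping pong `(D, B1, B2, h1, h2)`. -/
theorem sensitive_action_on_regular_curve_has_semi_ping_pong
    {X : Type*} [MetricSpace X] [CompactSpace X] [ConnectedSpace X]
    (hreg : ∀ (x : X) (U : Set X), IsOpen U → x ∈ U →
      ∃ V : Set X, IsOpen V ∧ x ∈ V ∧ V ⊆ U ∧ (frontier V).Finite)
    (n : ℕ) (hn : 0 < n)
    (horder : ∀ U : Set X, IsOpen U → U.Nonempty →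
      ∃ V : Set X, IsOpen V ∧ V.Nonempty ∧ V ⊆ U ∧
        (frontier V).Finite ∧ (frontier V).ncard ≤ n)
    {G : Type*} [Group G] [MulAction G X]
    (hcont : ∀ g : G, Continuous fun x : X => g • x)
    (hsens : ∃ c > (0 : ℝ), ∀ U : Set X, IsOpen U → U.Nonempty →
      ∃ g : G, c < Metric.diam ((fun x => g • x) '' U)) :
    ∃ (D B1 B2 : Set X) (h1 h2 : G),
      IsOpen D ∧ D.Nonempty ∧
      IsOpen B1 ∧ B1.Nonempty ∧ IsOpen B2 ∧ B2.Nonempty ∧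
      B1 ⊆ D ∧ B2 ⊆ D ∧ B1 ∩ B2 = ∅ ∧
      (fun x => h1 • x) '' D ⊆ B1 ∧ (fun x => h2 • x) '' D ⊆ B2 := by
  obtain ⟨c, hc, hsens⟩ := hsens
  have : ContinuousConstSMul G X := ⟨hcont⟩
  have := locallyConnectedSpace_of_finite_frontier_basis hreg
  obtain ⟨S, hS, hSo, hSU⟩ := exists_finite_family_subset_of_ncard_frontier_le (X := X) n hc
  have hcontract : ∀ O : Set X, IsOpen O → O.Nonempty →
      ∃ W ∈ S, ∃ g : G, (fun x => g • x) '' W ⊆ O := by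
    intro O hO hOne
    obtain ⟨V, hV, ⟨x, hx⟩, hVO, hVf, hVn⟩ := horder O hO hOne
    set C := connectedComponentIn V x
    have hCo : IsOpen C := hV.connectedComponentIn
    obtain ⟨g, hg⟩ := hsens C hCo ⟨x, mem_connectedComponentIn hx⟩
    have hfr : frontier ((fun y => g • y) '' C) = (fun y => g • y) '' frontier C :=
      ((Homeomorph.smul g).image_frontier C).symm
    have hCf : (frontier C).Finite := hVf.subset (frontier_connectedComponentIn_subset hV x)
    obtain ⟨W, hW, hWC⟩ := hSU ((fun y => g • y) '' C) (isOpenMap_smul g _ hCo)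
      (isPreconnected_connectedComponentIn.image _ (hcont g).continuousOn)
      (hfr ▸ hCf.image _)
      (by
        rw [hfr]
        exact (Set.ncard_image_le hCf).trans
          ((Set.ncard_le_ncard (frontier_connectedComponentIn_subset hV x) hVf).trans hVn)) hg
    refine ⟨W, hW, g⁻¹, ?_⟩
    rintro _ ⟨y, hy, rfl⟩
    obtain ⟨z, hz, rfl⟩ := hWC hy
    simpa using hVO (connectedComponentIn_subset V x hz)
  obtain ⟨D, hD, hDO⟩ := exists_mem_forall_isOpen_exists_smul_subset (G := G) hS hcontract
  obtain ⟨hDo, hDne⟩ := hSo D hD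
  obtain ⟨a, ha, b, hb, hab⟩ : D.Nontrivial := by
    rw [← Set.not_subsingleton_iff]
    intro hsub
    obtain ⟨g, hg⟩ := hsens D hDo hDne
    rw [Metric.diam_subsingleton (hsub.image _)] at hg
    exact hc.not_gt hg
  obtain ⟨A, B, hA, hB, haA, hbB, hAB⟩ := t2_separation hab
  obtain ⟨h1, hh1⟩ := hDO (D ∩ A) Set.inter_subset_left (hDo.inter hA) ⟨a, ha, haA⟩
  obtain ⟨h2, hh2⟩ := hDO (D ∩ B) Set.inter_subset_left (hDo.inter hB) ⟨b, hb, hbB⟩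
  exact ⟨D, D ∩ A, D ∩ B, h1, h2, hDo, hDne, hDo.inter hA, ⟨a, ha, haA⟩, hDo.inter hB,
    ⟨b, hb, hbB⟩, Set.inter_subset_left, Set.inter_subset_left,
    (hAB.mono Set.inter_subset_right Set.inter_subset_right).inter_eq, hh1, hh2⟩
end
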